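/- Let m be an integer and F a nonempty family of subsets of [n] = {1,...,n} with ∅ ∉ F. If |A| + m > 0 for all A ∈ F, then ∑_{X ∈ U_n(F)} (|Z_F(X)| + m) / ((|X| + m) · binomial(n + m, |X| + m)) = 1. -/

import Mathlib

open Finset

def upSet (n : ℕ) (F : Finset (Finset (Fin n))) : Finset (Finset (Fin n)) :=
  univ.filter (fun X => ∃ A ∈ F, A ⊆ X)

def downSet (n : ℕ) (F : Finset (Finset (Fin n))) : Finset (Finset (Fin n)) :=
  univ.filter (fun X => ∃ A ∈ F, X ⊆ A)

def zSet (n : ℕ) (F : Finset (Finset (Fin n))) (X : Finset (Fin n)) : Finset (Fin n) :=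
  if X ∈ upSet n F then (F.filter (fun A => A ⊆ X)).inf id else ∅

def joinFam (n : ℕ) (F G : Finset (Finset (Fin n))) : Finset (Finset (Fin n)) :=
  (F ×ˢ G).image (fun p => p.1 ∪ p.2)

noncomputable def g (a m : ℝ) (n l : ℕ) : ℝ :=
  (Nat.factorial (n - l) : ℝ) * a ^ (n - l) / ∏ k ∈ Finset.Icc l n, (a * k + m)

lemma mem_upSet {n : ℕ} {F : Finset (Finset (Fin n))} {X : Finset (Fin n)} :
    X ∈ upSet n F ↔ ∃ A ∈ F, A ⊆ X := by
  simp [upSet]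

lemma mem_upSet_of_subset {n : ℕ} {F : Finset (Finset (Fin n))} {X Y : Finset (Fin n)}
    (hX : X ∈ upSet n F) (hXY : X ⊆ Y) : Y ∈ upSet n F := by
  obtain ⟨A, hA, hAX⟩ := mem_upSet.1 hX
  exact mem_upSet.2 ⟨A, hA, hAX.trans hXY⟩

lemma zSet_eq_filter_erase_notMem {n : ℕ} {F : Finset (Finset (Fin n))} {X : Finset (Fin n)}
    (hX : X ∈ upSet n F) : zSet n F X = X.filter (fun x => X.erase x ∉ upSet n F) := by
  ext x
  rw [zSet, if_pos hX, Finset.mem_inf, mem_filter, mem_upSet]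
  constructor
  · intro h
    obtain ⟨A, hA, hAX⟩ := mem_upSet.1 hX
    refine ⟨hAX (h A (mem_filter.2 ⟨hA, hAX⟩)), ?_⟩
    rintro ⟨B, hB, hBX⟩
    exact notMem_erase x X (hBX (h B (mem_filter.2 ⟨hB, hBX.trans (erase_subset x X)⟩)))
  · rintro ⟨-, h⟩ A hA
    rw [mem_filter] at hA
    by_contra hxA
    exact h ⟨A, hA.1, subset_erase.2 ⟨hA.2, hxA⟩⟩

lemma sum_card_erase_mem_upSet {n : ℕ} (F : Finset (Finset (Fin n))) (w : ℕ → ℝ) :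
    ∑ X ∈ upSet n F, (#(X.filter (fun x => X.erase x ∈ upSet n F)) : ℝ) * w #X
      = ∑ X ∈ upSet n F, ((n : ℝ) - #X) * w (#X + 1) := by
  have hcompl (X : Finset (Fin n)) : (n : ℝ) - #X = #Xᶜ := by
    have := card_add_card_compl X
    rw [Fintype.card_fin] at this
    rw [sub_eq_iff_eq_add']
    exact_mod_cast this.symm
  simp_rw [hcompl, ← nsmul_eq_mul, ← sum_const]
  rw [sum_sigma', sum_sigma']
  refine sum_bij' (fun p _ => ⟨p.1.erase p.2, p.2⟩) (fun p _ => ⟨insert p.2 p.1, p.2⟩)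
    ?_ ?_ ?_ ?_ ?_
  · rintro ⟨X, x⟩ h
    simp only [mem_sigma, mem_filter] at h
    simpa using h.2.2
  · rintro ⟨X, x⟩ h
    simp only [mem_sigma, mem_compl] at h
    simpa [erase_insert h.2, h.1] using mem_upSet_of_subset h.1 (subset_insert x X)
  · rintro ⟨X, x⟩ h
    simp only [mem_sigma, mem_filter] at h
    simp [insert_erase h.2.1]
  · rintro ⟨X, x⟩ h
    simp only [mem_sigma, mem_compl] at h
    simp [erase_insert h.2]
  · rintro ⟨X, x⟩ h
    simp only [mem_sigma, mem_filter] at h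
    simp only [card_erase_add_one h.2.1]

/-- The weights `1 / ((k + m) * (n + m).choose (k + m))` satisfy a two-term recursion. -/
lemma sub_mul_inv_choose_succ {n k : ℕ} {m : ℤ} (hk : 0 < (k : ℤ) + m) (hkn : k < n) :
    ((n : ℝ) - k) *
        ((((k + 1 : ℕ) : ℝ) + m) *
          (Nat.choose ((n : ℤ) + m).toNat (((k + 1 : ℕ) : ℤ) + m).toNat))⁻¹
      = ((k : ℝ) + m) *
        (((k : ℝ) + m) * (Nat.choose ((n : ℤ) + m).toNat ((k : ℤ) + m).toNat))⁻¹ := by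
  obtain ⟨a, ha⟩ := Int.eq_ofNat_of_zero_le hk.le
  obtain ⟨d, rfl⟩ := Nat.exists_eq_add_of_lt hkn
  have hN : (((k + d + 1 : ℕ) : ℤ) + m).toNat = a + (d + 1) := by omega
  have hS : (((k + 1 : ℕ) : ℤ) + m).toNat = a + 1 := by omega
  have hA : ((k : ℤ) + m).toNat = a := by omega
  have haR : (k : ℝ) + m = a := by exact_mod_cast ha
  have hSR : ((k + 1 : ℕ) : ℝ) + m = a + 1 := by
    push_cast
    linarith
  have ha0 : (a : ℝ) ≠ 0 := by
    have : a ≠ 0 := by omega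
    exact_mod_cast this
  have hchoose : ((a + (d + 1)).choose (a + 1) : ℝ) * (a + 1)
      = (a + (d + 1)).choose a * (d + 1) := by
    have h := Nat.choose_succ_right_eq (a + (d + 1)) a
    rw [Nat.add_sub_cancel_left] at h
    exact_mod_cast h
  have hpos : ((a + (d + 1)).choose a : ℝ) ≠ 0 := by
    exact_mod_cast (Nat.choose_pos (Nat.le_add_right a (d + 1))).ne'
  have hd : (d : ℝ) + 1 ≠ 0 := by positivity
  rw [hN, hS, hA, hSR, haR, mul_comm ((a : ℝ) + 1), hchoose]
  push_cast
  field_simp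
  ring

/-- Thu's generalization of the AZ identity with an integer shift m. -/
theorem az_identity_shifted (n : ℕ) (m : ℤ) (F : Finset (Finset (Fin n)))
    (hF : F.Nonempty) (hne : ∅ ∉ F)
    (hm : ∀ A ∈ F, 0 < (A.card : ℤ) + m) :
    ∑ X ∈ upSet n F,
      (((zSet n F X).card : ℝ) + m) /
        (((X.card : ℝ) + m) * (Nat.choose ((n : ℤ) + m).toNat ((X.card : ℤ) + m).toNat))
      = 1 := by
  let w : ℕ → ℝ := fun k =>
    (((k : ℝ) + m) * (Nat.choose ((n : ℤ) + m).toNat ((k : ℤ) + m).toNat))⁻¹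
  have hpos : ∀ X ∈ upSet n F, 0 < (#X : ℤ) + m := by
    intro X hX
    obtain ⟨A, hA, hAX⟩ := mem_upSet.1 hX
    have := hm A hA
    have := card_le_card hAX
    omega
  have huniv : univ ∈ upSet n F := by
    obtain ⟨A, hA⟩ := hF
    exact mem_upSet.2 ⟨A, hA, subset_univ A⟩
  have hsplit : ∀ X ∈ upSet n F,
      (((zSet n F X).card : ℝ) + m) /
        (((X.card : ℝ) + m) * (Nat.choose ((n : ℤ) + m).toNat ((X.card : ℤ) + m).toNat))
      = ((#X : ℝ) + m) * w #X - #(X.filter (fun x => X.erase x ∈ upSet n F)) * w #X := by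
    intro X hX
    have hcard := card_filter_add_card_filter_not (s := X) (fun x => X.erase x ∈ upSet n F)
    rw [← zSet_eq_filter_erase_notMem hX] at hcard
    have hcardR : (#(X.filter (fun x => X.erase x ∈ upSet n F)) : ℝ) + #(zSet n F X) = #X := by
      exact_mod_cast hcard
    rw [div_eq_mul_inv, ← sub_mul]
    congr 1
    linarith
  rw [sum_congr rfl hsplit, sum_sub_distrib, sum_card_erase_mem_upSet, ← sum_sub_distrib,
    sum_eq_single_of_mem univ huniv]
  · have hn := hpos univ huniv
    simp only [card_univ, Fintype.card_fin] at hn ⊢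
    have hnR : (n : ℝ) + m ≠ 0 := by exact_mod_cast hn.ne'
    simp [w, hnR]
  · intro X hX hne_univ
    have hlt : #X < n := by
      simpa using card_lt_card (ssubset_univ_iff.2 hne_univ)
    rw [sub_mul_inv_choose_succ (hpos X hX) hlt, sub_self]
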